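/- Let H be a hyperplane of T and u ∈ V' with r·u ∉ H. Then any two distinct vertices from C(H,u) have exactly q^{4e-2} + q^{4e-3} − q^{4e-4} − q^{2e-2} common neighbours in the graph X(2e,K). -/

import Mathlib

open Matrix

/-- The symplectic form `a M bᵀ` where `M = [[0, Iₑ],[-Iₑ, 0]]`. -/
def sympForm (K : Type) [CommRing K] (e : ℕ) (a b : Fin e ⊕ Fin e → K) : K :=
  a ⬝ᵥ ((Matrix.fromBlocks (0 : Matrix (Fin e) (Fin e) K) 1 (-1) 0) *ᵥ b)

/-- `V'`: the set of 2e-tuples over `K` having at least one unit entry. -/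
def unitTuples (K : Type) [CommRing K] (e : ℕ) : Set (Fin e ⊕ Fin e → K) :=
  {a | ∃ i, IsUnit (a i)}

/-- The equivalence class `[a]` of a tuple under unit scaling. -/
def cls (K : Type) [CommRing K] (e : ℕ) (a : Fin e ⊕ Fin e → K) :
    Set (Fin e ⊕ Fin e → K) :=
  {b | ∃ σ : Kˣ, b = σ • a}

/-- `V`: the set of equivalence classes of elements of `V'` under unit scaling. -/
def classes (K : Type) [CommRing K] (e : ℕ) : Set (Set (Fin e ⊕ Fin e → K)) :=
  {S | ∃ a ∈ unitTuples K e, S = cls K e a}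

/-- Adjacency in the graph `X(2e,K)`: `a M bᵀ ∈ K \ {0}`. -/
def adjX (K : Type) [CommRing K] (e : ℕ) (A B : Set (Fin e ⊕ Fin e → K)) : Prop :=
  ∃ a ∈ A, ∃ b ∈ B, sympForm K e a b ≠ 0

/-- Adjacency in the complement of `X(2e,K)`: distinct classes with `a M bᵀ = 0`. -/
def adjXc (K : Type) [CommRing K] (e : ℕ) (A B : Set (Fin e ⊕ Fin e → K)) : Prop :=
  A ≠ B ∧ ∃ a ∈ A, ∃ b ∈ B, sympForm K e a b = 0

/-- Adjacency in the graph `Y(2e,K)`: `a M bᵀ ∈ J \ {0}`. -/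
def adjY (K : Type) [CommRing K] (J : Ideal K) (e : ℕ)
    (A B : Set (Fin e ⊕ Fin e → K)) : Prop :=
  ∃ a ∈ A, ∃ b ∈ B, sympForm K e a b ∈ J ∧ sympForm K e a b ≠ 0

/-- `T = J × ⋯ × J` (2e factors), as a subset of `K^{2e}`. -/
def Tset (K : Type) [CommRing K] (J : Ideal K) (e : ℕ) : Set (Fin e ⊕ Fin e → K) :=
  {x | ∀ i, x i ∈ J}

/-- A hyperplane of `T`: a `K`-submodule contained in `T` of cardinality `q^(2e-1)`. -/
def IsHyperplane (K : Type) [CommRing K] (J : Ideal K) (e q : ℕ)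
    (H : Submodule K (Fin e ⊕ Fin e → K)) : Prop :=
  (H : Set (Fin e ⊕ Fin e → K)) ⊆ Tset K J e ∧ Nat.card H = q ^ (2 * e - 1)

/-- `C(H,u) = {[u+h] : h ∈ H}`. -/
def classSet (K : Type) [CommRing K] (e : ℕ) (H : Submodule K (Fin e ⊕ Fin e → K))
    (u : Fin e ⊕ Fin e → K) : Set (Set (Fin e ⊕ Fin e → K)) :=
  {S | ∃ h ∈ (H : Set (Fin e ⊕ Fin e → K)), S = cls K e (u + h)}

/-- The set of tuples `{σ • (u+h) : σ ∈ Kˣ, h ∈ H}`. -/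
def orbitSet (K : Type) [CommRing K] (e : ℕ) (H : Submodule K (Fin e ⊕ Fin e → K))
    (u : Fin e ⊕ Fin e → K) : Set (Fin e ⊕ Fin e → K) :=
  {x | ∃ σ : Kˣ, ∃ h ∈ (H : Set (Fin e ⊕ Fin e → K)), x = σ • (u + h)}

/-- The coset `c • u + T` of `T`. -/
def cosetOf (K : Type) [CommRing K] (J : Ideal K) (e : ℕ) (c : K)
    (u : Fin e ⊕ Fin e → K) : Set (Fin e ⊕ Fin e → K) :=
  {x | ∃ t ∈ Tset K J e, x = c • u + t}

/-- Preimages under a surjective homomorphism of finite groups have proportional size. -/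
lemma card_preimage_mul_card {G G' : Type*} [AddGroup G] [AddGroup G'] (f : G →+ G')
    (hf : Function.Surjective f) (S : Set G') :
    Nat.card (f ⁻¹' S) * Nat.card G' = Nat.card S * Nat.card G := by
  obtain ⟨g, hg⟩ := hf.hasRightInverse
  have key : ∀ S : Set G', Nat.card (f ⁻¹' S) = Nat.card S * Nat.card f.ker := by
    intro S
    rw [← Nat.card_prod]
    exact Nat.card_congr
      { toFun := fun x => (⟨f x, x.2⟩, ⟨x - g (f x), by simp [AddMonoidHom.mem_ker, hg (f x)]⟩)
        invFun := fun p => ⟨p.2 + g p.1, by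
          have h := AddMonoidHom.mem_ker.1 p.2.2
          simp [h, hg p.1.1]⟩
        left_inv := fun x => by simp
        right_inv := fun p => by
          have h := AddMonoidHom.mem_ker.1 p.2.2
          ext <;> simp [h, hg p.1.1] }
  have h1 := key S
  have h2 := key Set.univ
  rw [Set.preimage_univ, Nat.card_univ, Nat.card_univ] at h2
  rw [h1, h2]
  ring

section ChainRing

variable {K : Type} [CommRing K] {J : Ideal K} {r : K}

lemma mem_iff_not_isUnit_of_ideals (hJtop : J ≠ ⊤)
    (hideals : ∀ I : Ideal K, I = ⊥ ∨ I = J ∨ I = ⊤) (x : K) : x ∈ J ↔ ¬ IsUnit x := by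
  constructor
  · intro hx hu
    exact hJtop (Ideal.eq_top_of_isUnit_mem _ hx hu)
  · intro hx
    have hm : x ∈ Ideal.span {x} := Ideal.mem_span_singleton_self x
    rcases hideals (Ideal.span {x}) with h | h | h
    · rw [h, Ideal.mem_bot] at hm
      rw [hm]
      exact J.zero_mem
    · rwa [h] at hm
    · exact absurd (Ideal.span_singleton_eq_top.1 h) hx

lemma generator_mul_eq_zero_iff (hJr : J = Ideal.span {r}) (hJbot : J ≠ ⊥) (hJtop : J ≠ ⊤)
    (hideals : ∀ I : Ideal K, I = ⊥ ∨ I = J ∨ I = ⊤) (x : K) : r * x = 0 ↔ x ∈ J := by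
  have hunit := mem_iff_not_isUnit_of_ideals hJtop hideals
  have hr0 : r ≠ 0 := fun h => hJbot (by rw [hJr, h]; simp)
  have hrJ : r ∈ J := hJr ▸ Ideal.mem_span_singleton_self r
  have hrr : r * r = 0 := by
    rcases hideals (Ideal.span {r * r}) with h | h | h
    · exact Ideal.span_singleton_eq_bot.1 h
    · exfalso
      have hm : r ∈ Ideal.span {r * r} := h ▸ hrJ
      obtain ⟨s, hs⟩ := Ideal.mem_span_singleton'.1 hm
      have hu : IsUnit (1 - s * r) := by
        by_contra hn
        have h1 := J.add_mem ((hunit _).2 hn) (J.mul_mem_left s hrJ)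
        rw [sub_add_cancel] at h1
        exact (hunit 1).1 h1 isUnit_one
      refine hr0 (hu.mul_left_eq_zero.1 ?_)
      linear_combination -hs
    · exact absurd (isUnit_of_mul_isUnit_left (Ideal.span_singleton_eq_top.1 h))
        ((hunit r).1 hrJ)
  constructor
  · intro h
    rw [hunit]
    exact fun hu => hr0 (hu.mul_left_eq_zero.1 h)
  · intro h
    rw [hJr] at h
    obtain ⟨s, rfl⟩ := Ideal.mem_span_singleton'.1 h
    linear_combination s * hrr

lemma card_ideal_eq_card_quotient (hJr : J = Ideal.span {r})
    (hann : ∀ x : K, r * x = 0 ↔ x ∈ J) : Nat.card J = Nat.card (K ⧸ J) := by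
  have ht : Ideal.torsionOf K K r = J := by
    ext x
    rw [Ideal.mem_torsionOf_iff, smul_eq_mul, mul_comm, hann]
  have h := Nat.card_congr (Ideal.quotTorsionOfEquivSpanSingleton K K r).toEquiv
  rw [ht] at h
  rw [h, hJr]

lemma card_units_add_card_ideal [Finite K] (hunit : ∀ x : K, x ∈ J ↔ ¬ IsUnit x) :
    Nat.card Kˣ + Nat.card J = Nat.card K := by
  have h1 : Nat.card Kˣ = Set.ncard ((J : Set K)ᶜ) := by
    rw [← Nat.card_coe_set_eq]
    refine Nat.card_congr (Equiv.ofBijective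
      (fun x : Kˣ => (⟨x, fun h => (hunit _).1 h x.isUnit⟩ : ((J : Set K)ᶜ : Set K)))
      ⟨fun x y h => Units.ext (congrArg Subtype.val h), fun y => ?_⟩)
    have hy : IsUnit (y : K) := not_not.1 (mt (hunit _).2 y.2)
    exact ⟨hy.unit, rfl⟩
  have h2 : Nat.card J = Set.ncard (J : Set K) := Nat.card_coe_set_eq _
  rw [h1, h2, add_comm, Set.ncard_add_ncard_compl]

/-- The number of `(s, t)` such that `s` and `s + r t` are both nonzero. -/
lemma card_pairs_add [Finite K] (hann : ∀ x : K, r * x = 0 ↔ x ∈ J) :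
    Nat.card {p : K × K | p.1 ≠ 0 ∧ p.1 + r * p.2 ≠ 0} + 2 * Nat.card K =
      Nat.card K ^ 2 + Nat.card J := by
  set A : Set (K × K) := {p | p.1 = 0} with hA
  set B : Set (K × K) := {p | p.1 + r * p.2 = 0} with hB
  have hS : {p : K × K | p.1 ≠ 0 ∧ p.1 + r * p.2 ≠ 0} = (A ∪ B)ᶜ := by
    ext p
    simp [hA, hB]
  have cA : A.ncard = Nat.card K := by
    rw [← Set.ncard_univ, ← Set.ncard_image_of_injective (f := fun t : K => ((0 : K), t))
      Set.univ (fun x y h => by simpa using h)]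
    congr 1
    ext ⟨s, t⟩
    simp [hA, eq_comm]
  have cB : B.ncard = Nat.card K := by
    rw [← Set.ncard_univ, ← Set.ncard_image_of_injective (f := fun t : K => (-(r * t), t))
      Set.univ (fun x y h => by simpa using (congrArg Prod.snd h))]
    congr 1
    ext ⟨s, t⟩
    simp [hB, eq_neg_iff_add_eq_zero, eq_comm]
  have cAB : (A ∩ B).ncard = Nat.card J := by
    have h2 : Nat.card J = Set.ncard (J : Set K) := Nat.card_coe_set_eq _
    rw [h2, ← Set.ncard_image_of_injective (f := fun t : K => ((0 : K), t))
      (J : Set K) (fun x y h => by simpa using h)]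
    congr 1
    ext ⟨s, t⟩
    simp only [hA, hB, Set.mem_inter_iff, Set.mem_ofPred_eq, Set.mem_image, SetLike.mem_coe,
      Prod.mk.injEq]
    constructor
    · rintro ⟨rfl, h⟩
      exact ⟨t, (hann t).1 (by simpa using h), rfl, rfl⟩
    · rintro ⟨x, hx, rfl, rfl⟩
      simpa using (hann x).2 hx
  have h1 := Set.ncard_union_add_ncard_inter A B
  have h2 := Set.ncard_add_ncard_compl (A ∪ B)
  rw [Nat.card_prod] at h2
  rw [hS, Nat.card_coe_set_eq, pow_two]
  lia

end ChainRing

section Form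

variable {K : Type} [CommRing K] {e : ℕ}

lemma sympForm_add_left (x y z : Fin e ⊕ Fin e → K) :
    sympForm K e (x + y) z = sympForm K e x z + sympForm K e y z := by
  simp [sympForm, add_dotProduct]

lemma sympForm_add_right (x y z : Fin e ⊕ Fin e → K) :
    sympForm K e x (y + z) = sympForm K e x y + sympForm K e x z := by
  simp [sympForm, mulVec_add, dotProduct_add]

lemma sympForm_smul_left (c : K) (x y : Fin e ⊕ Fin e → K) :
    sympForm K e (c • x) y = c * sympForm K e x y := by
  simp [sympForm]

lemma sympForm_smul_right (c : K) (x y : Fin e ⊕ Fin e → K) :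
    sympForm K e x (c • y) = c * sympForm K e x y := by
  simp [sympForm, mulVec_smul]

/-- Every coordinate is represented by pairing with some tuple. -/
lemma exists_sympForm_eq_apply (i : Fin e ⊕ Fin e) :
    ∃ x : Fin e ⊕ Fin e → K, ∀ y, sympForm K e x y = y i := by
  refine ⟨Pi.single i 1 ᵥ* (-(Matrix.fromBlocks (0 : Matrix (Fin e) (Fin e) K) 1 (-1) 0)),
    fun y => ?_⟩
  rw [sympForm, ← dotProduct_mulVec, mulVec_mulVec, neg_mul, fromBlocks_multiply]
  simp [fromBlocks_neg]

lemma sympForm_mem (J : Ideal K) {x : Fin e ⊕ Fin e → K} (hx : ∀ i, x i ∈ J)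
    (y : Fin e ⊕ Fin e → K) : sympForm K e x y ∈ J := by
  unfold sympForm dotProduct
  exact Ideal.sum_mem J fun i _ => J.mul_mem_right _ (hx i)

lemma mem_cls_self (a : Fin e ⊕ Fin e → K) : a ∈ cls K e a := ⟨1, by simp⟩

lemma cls_units_smul (σ : Kˣ) (a : Fin e ⊕ Fin e → K) : cls K e (σ • a) = cls K e a := by
  ext b
  constructor
  · rintro ⟨τ, rfl⟩
    exact ⟨τ * σ, by rw [mul_smul]⟩
  · rintro ⟨τ, rfl⟩
    exact ⟨τ * σ⁻¹, by rw [mul_smul, inv_smul_smul]⟩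

lemma adjX_cls_iff (a b : Fin e ⊕ Fin e → K) :
    adjX K e (cls K e a) (cls K e b) ↔ sympForm K e a b ≠ 0 := by
  constructor
  · rintro ⟨_, ⟨σ, rfl⟩, _, ⟨τ, rfl⟩, h⟩ h0
    apply h
    rw [Units.smul_def, Units.smul_def, sympForm_smul_left, sympForm_smul_right, h0]
    simp
  · intro h
    exact ⟨a, mem_cls_self a, b, mem_cls_self b, h⟩

lemma units_smul_mem_unitTuples (σ : Kˣ) {a : Fin e ⊕ Fin e → K} (ha : a ∈ unitTuples K e) :
    σ • a ∈ unitTuples K e := by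
  obtain ⟨i, hi⟩ := ha
  exact ⟨i, by rw [Pi.smul_apply, Units.smul_def, smul_eq_mul]; exact σ.isUnit.mul hi⟩

/-- Passing from classes to representatives multiplies cardinalities by the number of units. -/
lemma card_classes_mul_card_units (P : Set (Set (Fin e ⊕ Fin e → K))) :
    Nat.card {C ∈ classes K e | C ∈ P} * Nat.card Kˣ =
      Nat.card {x ∈ unitTuples K e | cls K e x ∈ P} := by
  rw [← Nat.card_prod]
  have hc : ∀ C : {C ∈ classes K e | C ∈ P}, ∃ a ∈ unitTuples K e, C.1 = cls K e a :=
    fun C => C.2.1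
  choose c hcu hcc using hc
  refine Nat.card_congr (Equiv.ofBijective
    (fun p => ⟨p.2 • c p.1, units_smul_mem_unitTuples _ (hcu _), by
      rw [cls_units_smul, ← hcc]
      exact p.1.2.2⟩) ⟨?_, ?_⟩)
  · rintro ⟨C, σ⟩ ⟨D, τ⟩ h
    have h' : σ • c C = τ • c D := congrArg Subtype.val h
    have hCD : C = D := by
      ext1
      rw [hcc C, hcc D, ← cls_units_smul σ, h', cls_units_smul]
    subst hCD
    obtain ⟨i, hi⟩ := hcu C
    have hστ : (σ : K) * c C i = τ * c C i := congrFun h' i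
    rw [Units.ext (hi.mul_right_cancel hστ)]
  · rintro ⟨x, hx, hxP⟩
    let C : {C ∈ classes K e | C ∈ P} := ⟨cls K e x, ⟨x, hx, rfl⟩, hxP⟩
    have hm : x ∈ cls K e (c C) := by
      rw [← hcc C]
      exact mem_cls_self x
    obtain ⟨σ, hσ⟩ := hm
    exact ⟨(C, σ), Subtype.ext hσ.symm⟩

/-- Two distinct classes congruent modulo `J` have normalised representatives which agree in a
coordinate equal to one and differ by a multiple of `r` that is nonzero in another coordinate. -/
lemma exists_normalised_representatives {J : Ideal K} {r : K} (hJr : J = Ideal.span {r})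
    (hunit : ∀ x : K, x ∈ J ↔ ¬ IsUnit x) (hann : ∀ x : K, r * x = 0 ↔ x ∈ J)
    {u h k : Fin e ⊕ Fin e → K} (hu : u ∈ unitTuples K e)
    (hh : ∀ i, h i ∈ J) (hk : ∀ i, k i ∈ J) (hne : cls K e (u + h) ≠ cls K e (u + k)) :
    ∃ (i j : Fin e ⊕ Fin e) (a w : Fin e ⊕ Fin e → K), a i = 1 ∧ w i = 0 ∧ IsUnit (w j) ∧
      cls K e (u + h) = cls K e a ∧ cls K e (u + k) = cls K e (a + r • w) := by
  obtain ⟨i, hi⟩ := hu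
  have hadd : ∀ z ∈ J, IsUnit (u i + z) := by
    intro z hz
    by_contra hn
    have := J.sub_mem ((hunit _).2 hn) hz
    rw [add_sub_cancel_right] at this
    exact (hunit _).1 this hi
  obtain ⟨α, hα⟩ := hadd _ (hh i)
  obtain ⟨β, hβ⟩ := hadd _ (hk i)
  set a := α⁻¹ • (u + h) with ha
  set b := β⁻¹ • (u + k) with hb
  have hai : a i = 1 := by
    rw [ha, Pi.smul_apply, Pi.add_apply, ← hα, Units.smul_def, smul_eq_mul, Units.inv_mul]
  have hbi : b i = 1 := by
    rw [hb, Pi.smul_apply, Pi.add_apply, ← hβ, Units.smul_def, smul_eq_mul, Units.inv_mul]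
  have hdiff : ∀ l, ∃ s, r * s = b l - a l := by
    intro l
    have hmem : b l - a l ∈ Ideal.span {r} := by
      rw [← hJr]
      have h1 : (α : K) * a l = u l + h l := by
        rw [ha, Pi.smul_apply, Units.smul_def, smul_eq_mul, Units.mul_inv_cancel_left]; rfl
      have h2 : (β : K) * b l = u l + k l := by
        rw [hb, Pi.smul_apply, Units.smul_def, smul_eq_mul, Units.mul_inv_cancel_left]; rfl
      have h3 : (α : K) * (b l - a l) = k l - h l + (h i - k i) * b l := by
        linear_combination (h2 - h1) + b l * (hα - hβ)
      have h4 : b l - a l = α⁻¹ * (k l - h l + (h i - k i) * b l) := by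
        rw [← h3, Units.inv_mul_cancel_left]
      rw [h4]
      exact J.mul_mem_left _ (J.add_mem (J.sub_mem (hk l) (hh l))
        (J.mul_mem_right _ (J.sub_mem (hh i) (hk i))))
    obtain ⟨s, hs⟩ := Ideal.mem_span_singleton'.1 hmem
    exact ⟨s, by rw [mul_comm, hs]⟩
  choose w₀ hw₀ using hdiff
  have hw : ∀ l, r * Function.update w₀ i 0 l = b l - a l := by
    intro l
    by_cases hl : l = i
    · subst hl
      simp [hai, hbi]
    · rw [Function.update_of_ne hl, hw₀]
  have hba : b = a + r • Function.update w₀ i 0 := by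
    ext l
    rw [Pi.add_apply, Pi.smul_apply, smul_eq_mul, hw]
    ring
  have hab : b ≠ a := by
    intro hba'
    apply hne
    rw [← cls_units_smul α⁻¹ (u + h), ← cls_units_smul β⁻¹ (u + k), ← ha, ← hb, hba']
  obtain ⟨j, hj⟩ := Function.ne_iff.1 hab
  refine ⟨i, j, a, Function.update w₀ i 0, hai, Function.update_self .., ?_, ?_, ?_⟩
  · by_contra hn
    have h0 := (hann _).2 ((hunit _).2 hn)
    rw [hw] at h0
    exact hj (sub_eq_zero.1 h0)
  · rw [ha, cls_units_smul]
  · rw [← hba, hb, cls_units_smul]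

lemma sympForm_pair_surjective {i j : Fin e ⊕ Fin e} {a w : Fin e ⊕ Fin e → K}
    (hai : a i = 1) (hwi : w i = 0) (hwj : IsUnit (w j)) (s t : K) :
    ∃ x, sympForm K e x a = s ∧ sympForm K e x w = t := by
  obtain ⟨x, hx⟩ := exists_sympForm_eq_apply (K := K) i
  obtain ⟨y, hy⟩ := exists_sympForm_eq_apply (K := K) j
  obtain ⟨v, hv⟩ := hwj
  refine ⟨(s - t * ↑v⁻¹ * a j) • x + (t * ↑v⁻¹) • y, ?_, ?_⟩
  · rw [sympForm_add_left, sympForm_smul_left, sympForm_smul_left, hx, hy, hai]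
    ring
  · rw [sympForm_add_left, sympForm_smul_left, sympForm_smul_left, hx, hy, hwi, ← hv,
      mul_zero, zero_add, mul_assoc, Units.inv_mul, mul_one]

/-- Pairing with `a`, on tuples with entries in `J`. -/
def sympFormIdealHom (J : Ideal K) (a : Fin e ⊕ Fin e → K) : (Fin e ⊕ Fin e → J) →+ J where
  toFun x := ⟨sympForm K e (fun i => (x i : K)) a, sympForm_mem J (fun i => (x i).2) a⟩
  map_zero' := by ext; simp [sympForm, dotProduct]
  map_add' x y := Subtype.ext (sympForm_add_left (fun i => (x i : K)) (fun i => (y i : K)) a)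

/-- Simultaneous pairing with `a` and `w`. -/
def sympFormPairHom (a w : Fin e ⊕ Fin e → K) : (Fin e ⊕ Fin e → K) →+ K × K where
  toFun x := (sympForm K e x a, sympForm K e x w)
  map_zero' := by simp [sympForm]
  map_add' x y := by ext <;> exact sympForm_add_left x y _

lemma card_nonorthogonal_mul [Finite K] {J : Ideal K} {r : K}
    (hann : ∀ x : K, r * x = 0 ↔ x ∈ J)
    {i j : Fin e ⊕ Fin e} {a w : Fin e ⊕ Fin e → K}
    (hai : a i = 1) (hwi : w i = 0) (hwj : IsUnit (w j)) :
    Nat.card {x | sympForm K e x a ≠ 0 ∧ sympForm K e x (a + r • w) ≠ 0} *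
        Nat.card K ^ 2 + 2 * Nat.card K * Nat.card K ^ (2 * e) =
      (Nat.card K ^ 2 + Nat.card J) * Nat.card K ^ (2 * e) := by
  have h := card_preimage_mul_card (sympFormPairHom a w)
    (fun p => by
      obtain ⟨x, h1, h2⟩ := sympForm_pair_surjective hai hwi hwj p.1 p.2
      exact ⟨x, Prod.ext h1 h2⟩) {p : K × K | p.1 ≠ 0 ∧ p.1 + r * p.2 ≠ 0}
  have hset : sympFormPairHom a w ⁻¹' {p : K × K | p.1 ≠ 0 ∧ p.1 + r * p.2 ≠ 0} =
      {x | sympForm K e x a ≠ 0 ∧ sympForm K e x (a + r • w) ≠ 0} := by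
    ext x
    simp [sympFormPairHom, sympForm_add_right, sympForm_smul_right]
  have hfun : Nat.card (Fin e ⊕ Fin e → K) = Nat.card K ^ (2 * e) := by
    rw [Nat.card_fun, Nat.card_sum, Nat.card_fin, two_mul]
  rw [hset, Nat.card_prod, hfun] at h
  rw [← card_pairs_add hann, add_mul, ← h, pow_two]

lemma card_nonorthogonal_ideal_mul [Finite K] {J : Ideal K} {r : K} (hJr : J = Ideal.span {r})
    (hunit : ∀ x : K, x ∈ J ↔ ¬ IsUnit x) (hann : ∀ x : K, r * x = 0 ↔ x ∈ J)
    {i : Fin e ⊕ Fin e} {a w : Fin e ⊕ Fin e → K} (hai : a i = 1) :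
    Nat.card ↥({x | sympForm K e x a ≠ 0 ∧ sympForm K e x (a + r • w) ≠ 0} \ unitTuples K e) *
        Nat.card J + Nat.card J ^ (2 * e) = Nat.card J * Nat.card J ^ (2 * e) := by
  have hrJ : r ∈ J := hJr ▸ Ideal.mem_span_singleton_self r
  have h := card_preimage_mul_card (sympFormIdealHom J a)
    (fun p => by
      obtain ⟨x, hx⟩ := exists_sympForm_eq_apply (K := K) i
      refine ⟨fun l => ⟨p * x l, J.mul_mem_right _ p.2⟩, Subtype.ext ?_⟩
      have h1 := sympForm_smul_left (p : K) x a
      rw [hx, hai, mul_one] at h1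
      exact h1) {0}ᶜ
  have hfun : Nat.card (Fin e ⊕ Fin e → J) = Nat.card J ^ (2 * e) := by
    rw [Nat.card_fun, Nat.card_sum, Nat.card_fin, two_mul]
  have hcompl : Nat.card ↥({0}ᶜ : Set J) + 1 = Nat.card J := by
    rw [Nat.card_coe_set_eq, ← Set.ncard_singleton (0 : J), add_comm, Set.ncard_add_ncard_compl]
  have hinj : Function.Injective
      (fun (x : Fin e ⊕ Fin e → J) (i : Fin e ⊕ Fin e) => (x i : K)) :=
    fun x y hxy => funext fun l => Subtype.ext (congrFun hxy l)
  have hset : {x | sympForm K e x a ≠ 0 ∧ sympForm K e x (a + r • w) ≠ 0} \ unitTuples K e =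
      (fun (x : Fin e ⊕ Fin e → J) (i : Fin e ⊕ Fin e) => (x i : K)) ''
        (sympFormIdealHom J a ⁻¹' {0}ᶜ) := by
    ext x
    constructor
    · rintro ⟨⟨h1, -⟩, h2⟩
      have hx : ∀ l, x l ∈ J := fun l => (hunit _).2 fun hl => h2 ⟨l, hl⟩
      exact ⟨fun l => ⟨x l, hx l⟩, fun h0 => h1 (congrArg Subtype.val h0), rfl⟩
    · rintro ⟨y, hy, rfl⟩
      have h1 : sympForm K e (fun l => (y l : K)) a ≠ 0 := fun h0 => hy (Subtype.ext h0)
      refine ⟨⟨h1, ?_⟩, ?_⟩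
      · rw [sympForm_add_right, sympForm_smul_right,
          (hann _).2 (sympForm_mem J (fun l => (y l).2) w), add_zero]
        exact h1
      · rintro ⟨l, hl⟩
        exact (hunit _).1 (y l).2 hl
  rw [hset, Nat.card_image_of_injective hinj, h, hfun, ← hcompl]
  ring

end Form

/-- Corollary: any two distinct vertices from a class `C(H,u)` have
`q^(4e-2) + q^(4e-3) - q^(4e-4) - q^(2e-2)` common neighbours in `X(2e,K)`. -/
theorem common_neighbours_X_same_class
    (K : Type) [CommRing K] [Fintype K]
    (J : Ideal K) (r : K) (q : ℕ)
    (hJr : J = Ideal.span {r})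
    (hJbot : J ≠ ⊥) (hJtop : J ≠ ⊤)
    (hideals : ∀ I : Ideal K, I = ⊥ ∨ I = J ∨ I = ⊤)
    (hq : IsPrimePow q)
    (hqcard : Nat.card (K ⧸ J) = q)
    (e : ℕ) (he : 2 ≤ e)
    (H : Submodule K (Fin e ⊕ Fin e → K)) (hH : IsHyperplane K J e q H)
    (u : Fin e ⊕ Fin e → K) (hu : u ∈ unitTuples K e) (hru : r • u ∉ H)
    (a b : Fin e ⊕ Fin e → K)
    (ha : a ∈ unitTuples K e) (hb : b ∈ unitTuples K e)
    (haC : cls K e a ∈ classSet K e H u) (hbC : cls K e b ∈ classSet K e H u)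
    (hab : cls K e a ≠ cls K e b) :
    Nat.card ↥{C ∈ classes K e | adjX K e C (cls K e a) ∧ adjX K e C (cls K e b)} =
      q ^ (4 * e - 2) + q ^ (4 * e - 3) - q ^ (4 * e - 4) - q ^ (2 * e - 2) := by
  have hunit := mem_iff_not_isUnit_of_ideals hJtop hideals
  have hann := generator_mul_eq_zero_iff hJr hJbot hJtop hideals
  have hJq : Nat.card J = q := by rw [card_ideal_eq_card_quotient hJr hann, hqcard]
  have hKq : Nat.card K = q ^ 2 := by
    rw [Submodule.card_eq_card_quotient_mul_card J, hJq, pow_two]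
    exact congrArg (q * ·) hqcard
  have hUq := card_units_add_card_ideal hunit
  rw [hJq, hKq] at hUq
  obtain ⟨h, hh, hah⟩ := haC
  obtain ⟨k, hk, hbk⟩ := hbC
  rw [hah, hbk] at hab ⊢
  obtain ⟨i, j, a', w, hai, hwi, hwj, hca, hcb⟩ :=
    exists_normalised_representatives hJr hunit hann hu (hH.1 hh) (hH.1 hk) hab
  rw [hca, hcb]
  have hcount := card_classes_mul_card_units
    {C | adjX K e C (cls K e a') ∧ adjX K e C (cls K e (a' + r • w))}
  simp only [Set.mem_ofPred_eq, adjX_cls_iff] at hcount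
  have hP := card_nonorthogonal_mul hann hai hwi hwj
  have hPT := card_nonorthogonal_ideal_mul (w := w) hJr hunit hann hai
  set P := {x | sympForm K e x a' ≠ 0 ∧ sympForm K e x (a' + r • w) ≠ 0} with hPdef
  have hsplit : Nat.card {x ∈ unitTuples K e | x ∈ P} + Nat.card ↥(P \ unitTuples K e) =
      Nat.card P := by
    rw [Nat.card_coe_set_eq, Nat.card_coe_set_eq, Nat.card_coe_set_eq,
      ← Set.ncard_inter_add_ncard_sdiff_eq_ncard P (unitTuples K e), Set.inter_comm]
    rfl
  rw [hKq, hJq] at hP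
  rw [hJq] at hPT
  have hq1 := hq.one_lt
  obtain ⟨m, rfl⟩ := Nat.exists_eq_add_of_le' he
  generalize Nat.card {C ∈ classes K (m + 2) |
    adjX K (m + 2) C (cls K (m + 2) a') ∧ adjX K (m + 2) C (cls K (m + 2) (a' + r • w))} = n
    at hcount ⊢
  have hN : Nat.card {x ∈ unitTuples K (m + 2) | x ∈ P} = n * Nat.card Kˣ := hcount.symm
  rw [hN] at hsplit
  generalize Nat.card Kˣ = U at hUq hsplit
  generalize Nat.card P = N at hP hsplit
  generalize Nat.card ↥(P \ unitTuples K (m + 2)) = D at hPT hsplit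
  have hsum : n + q ^ (2 * m + 2) + q ^ (4 * m + 4) = q ^ (4 * m + 6) + q ^ (4 * m + 5) := by
    zify at *
    have hU0 : (q : ℤ) ^ 4 * (q ^ 2 - q) ≠ 0 := by
      have h1 : (q : ℤ) ^ 2 - q = q * (q - 1) := by ring
      rw [h1]
      have h2 : (0 : ℤ) < q - 1 := by lia
      positivity
    refine mul_left_cancel₀ hU0 ?_
    linear_combination hP - (q : ℤ) ^ 3 * hPT + (q : ℤ) ^ 4 * hsplit - (q : ℤ) ^ 4 * n * hUq
  rw [show 4 * (m + 2) - 2 = 4 * m + 6 by lia, show 4 * (m + 2) - 3 = 4 * m + 5 by lia,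
    show 4 * (m + 2) - 4 = 4 * m + 4 by lia, show 2 * (m + 2) - 2 = 2 * m + 2 by lia]
  lia
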